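/- Let d ≥ 1 and N > 0. Let N₁ and N₂ be independent Poisson random variables with mean N, and given N₁ and N₂ let X₁,…,X_{N₁} and Y₁,…,Y_{N₂} be independent points uniformly distributed in [0,1]^d. Set M(N) = E L_MBM(X₁,…,X_{N₁}; Y₁,…,Y_{N₂}). Then for every integer K ≥ 1, M(N) ≤ 2^{K(d−1)} M(N / 2^{Kd}) + √(2 d N) Σ_{k=1}^{K} 2^{k(d/2 − 1)}. -/

import Mathlib

open MeasureTheory ProbabilityTheory Filter

noncomputable section

/-- The unit cube `[0,1]^d` in Euclidean space `ℝ^d`. -/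
def unitCube (d : ℕ) : Set (EuclideanSpace ℝ (Fin d)) :=
  {x | ∀ i, x i ∈ Set.Icc (0 : ℝ) 1}

/-- The uniform probability measure on the unit cube `[0,1]^d`
(the cube has Lebesgue measure one, so the restriction of Lebesgue measure
to the cube is the uniform probability measure on it). -/
def unifCube (d : ℕ) : Measure (EuclideanSpace ℝ (Fin d)) :=
  volume.restrict (unitCube d)

/-- `LMBMon X Y A B` is the minimum total Euclidean length of a partial bipartite
matching pairing `min A.card B.card` of the points `X j, j ∈ A` with as many of the
points `Y j, j ∈ B`, each pair consisting of one `X`-point and one `Y`-point. -/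
def LMBMon {d N₁ N₂ : ℕ} (X : Fin N₁ → EuclideanSpace ℝ (Fin d))
    (Y : Fin N₂ → EuclideanSpace ℝ (Fin d)) (A : Finset (Fin N₁)) (B : Finset (Fin N₂)) : ℝ :=
  sInf { s | ∃ (σ : Fin (min A.card B.card) ↪ Fin N₁) (τ : Fin (min A.card B.card) ↪ Fin N₂),
    (∀ i, σ i ∈ A) ∧ (∀ i, τ i ∈ B) ∧ s = ∑ i, dist (X (σ i)) (Y (τ i)) }

/-- `LMBM X Y` : the minimum total Euclidean length of a bipartite matching between the
points of `X` and the points of `Y`; if the two families have different cardinalities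
`N₁ ≠ N₂`, it is the minimum length of a partial matching pairing `min N₁ N₂` points of
each family, leaving `|N₁ - N₂|` points unmatched. -/
def LMBM {d N₁ N₂ : ℕ} (X : Fin N₁ → EuclideanSpace ℝ (Fin d))
    (Y : Fin N₂ → EuclideanSpace ℝ (Fin d)) : ℝ :=
  LMBMon X Y Finset.univ Finset.univ

/-- `MP d lam`: the expected length of a minimum bipartite matching in the Poissonized
model on `[0,1]^d` with intensity `lam`: the numbers `n₁, n₂` of points of the two
families are independent Poisson(lam) variables and the points are i.i.d. uniform
on the cube. -/
def MP (d : ℕ) (lam : ℝ) : ℝ :=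
  ∑' n₁ : ℕ, ∑' n₂ : ℕ,
    (Real.exp (-lam) * lam ^ n₁ / n₁.factorial) *
      ((Real.exp (-lam) * lam ^ n₂ / n₂.factorial) *
        ∫ p : (Fin n₁ → EuclideanSpace ℝ (Fin d)) × (Fin n₂ → EuclideanSpace ℝ (Fin d)),
          LMBM p.1 p.2 ∂ ((Measure.pi fun _ => unifCube d).prod (Measure.pi fun _ => unifCube d)))

end


noncomputable section helpers
variable {d : ℕ}

def msOf {α : Type*} {n : ℕ} (X : Fin n → α) : Multiset α := (Finset.univ : Finset (Fin n)).val.map X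

theorem msOf_card {α : Type*} {n : ℕ} (X : Fin n → α) : (msOf X).card = n := by simp [msOf]

theorem msOf_map {α β : Type*} {n : ℕ} (X : Fin n → α) (f : α → β) :
    (msOf X).map f = msOf (fun i => f (X i)) := by
  unfold msOf
  rw [Multiset.map_map]
  rfl

theorem msOf_toList {α : Type*} (S : Multiset α) : msOf (fun i => S.toList.get i) = S := by
  unfold msOf
  rw [Fin.univ_val_map]
  have := List.ofFn_get S.toList
  rw [this, Multiset.coe_toList]

theorem msOf_cons {α : Type*} {n : ℕ} (x : α) (v : Fin n → α) :
    msOf (Fin.cons x v : Fin (n+1) → α) = x ::ₘ msOf v := by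
  unfold msOf
  rw [Fin.univ_val_map, Fin.univ_val_map]
  simp [List.ofFn_succ]

abbrev EE (d : ℕ) := EuclideanSpace ℝ (Fin d)

structure Valid (S T : Multiset (EE d)) (P : Multiset (EE d × EE d)) : Prop where
  h1 : P.map Prod.fst ≤ S
  h2 : P.map Prod.snd ≤ T
  h3 : P.card = min S.card T.card

def cost (P : Multiset (EE d × EE d)) : ℝ := (P.map fun p => dist p.1 p.2).sum

theorem cost_nonneg (P : Multiset (EE d × EE d)) : 0 ≤ cost P := by
  apply Multiset.sum_nonneg
  intro x hx
  simp only [Multiset.mem_map] at hx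
  obtain ⟨p, _, rfl⟩ := hx
  exact dist_nonneg

theorem LMBM_set_finite {N₁ N₂ : ℕ} (X : Fin N₁ → EE d) (Y : Fin N₂ → EE d) (k : ℕ) :
    { s : ℝ | ∃ (σ : Fin k ↪ Fin N₁) (τ : Fin k ↪ Fin N₂),
    (∀ i, σ i ∈ (Finset.univ : Finset (Fin N₁))) ∧ (∀ i, τ i ∈ (Finset.univ : Finset (Fin N₂)))
      ∧ s = ∑ i, dist (X (σ i)) (Y (τ i)) } = Set.range
      (fun p : (Fin k ↪ Fin N₁) × (Fin k ↪ Fin N₂) => ∑ i, dist (X (p.1 i)) (Y (p.2 i))) := by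
  ext s
  simp [eq_comm]

theorem LMBM_eq {N₁ N₂ : ℕ} (X : Fin N₁ → EE d) (Y : Fin N₂ → EE d) :
    LMBM X Y = ⨅ p : (Fin (min N₁ N₂) ↪ Fin N₁) × (Fin (min N₁ N₂) ↪ Fin N₂),
      ∑ i, dist (X (p.1 i)) (Y (p.2 i)) := by
  unfold LMBM LMBMon
  rw [LMBM_set_finite, sInf_range, Finset.card_univ, Finset.card_univ, Fintype.card_fin,
    Fintype.card_fin]

theorem LMBM_nonneg {N₁ N₂ : ℕ} (X : Fin N₁ → EE d) (Y : Fin N₂ → EE d) : 0 ≤ LMBM X Y := by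
  rw [LMBM_eq]
  exact Real.iInf_nonneg fun p => Finset.sum_nonneg fun i _ => dist_nonneg

theorem LMBM_measurable (N₁ N₂ : ℕ) :
    Measurable (fun p : (Fin N₁ → EE d) × (Fin N₂ → EE d) => LMBM p.1 p.2) := by
  simp only [LMBM_eq]
  apply Measurable.iInf
  intro q
  fun_prop

theorem nodup_le_univ {n : ℕ} (s : Multiset (Fin n)) (h : s ≤ (Finset.univ : Finset (Fin n)).val) :
    s.Nodup := Multiset.nodup_of_le h Finset.univ.nodup

theorem exists_valid {N₁ N₂ : ℕ} (X : Fin N₁ → EE d) (Y : Fin N₂ → EE d) :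
    ∃ P, Valid (msOf X) (msOf Y) P ∧ cost P = LMBM X Y := by
  have : Nonempty ((Fin (min N₁ N₂) ↪ Fin N₁) × (Fin (min N₁ N₂) ↪ Fin N₂)) :=
    ⟨(Fin.castLEEmb (min_le_left _ _), Fin.castLEEmb (min_le_right _ _))⟩
  obtain ⟨p, hp⟩ := exists_eq_ciInf_of_finite
    (f := fun p : (Fin (min N₁ N₂) ↪ Fin N₁) × (Fin (min N₁ N₂) ↪ Fin N₂) =>
      ∑ i, dist (X (p.1 i)) (Y (p.2 i)))
  have key : ∀ {n k : ℕ} (e : Fin k ↪ Fin n) (Z : Fin n → EE d),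
      msOf (fun i => Z (e i)) ≤ msOf Z := by
    intro n k e Z
    rw [← msOf_map e Z]
    unfold msOf
    apply Multiset.map_le_map
    rw [Multiset.le_iff_subset (Finset.univ.nodup.map e.injective)]
    intro x _
    simp
  refine ⟨msOf (fun i => (X (p.1 i), Y (p.2 i))), ⟨?_, ?_, ?_⟩, ?_⟩
  · rw [msOf_map]; exact key _ _
  · rw [msOf_map]; exact key _ _
  · simp [msOf_card]
  · rw [LMBM_eq, ← hp, cost, msOf_map]; rfl

theorem lift_fst {α β : Type*} [DecidableEq α] (Z : α → β) {γ : Type*} (f : γ → β) (P : Multiset γ) :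
    ∀ (T : Multiset α), P.map f ≤ T.map Z →
    ∃ Q : Multiset (α × γ), Q.map Prod.snd = P ∧ (∀ q ∈ Q, Z q.1 = f q.2) ∧ Q.map Prod.fst ≤ T := by
  induction P using Multiset.induction_on with
  | empty => intro T _; exact ⟨0, by simp⟩
  | cons a P ih =>
    intro T h
    rw [Multiset.map_cons] at h
    have ha : f a ∈ T.map Z := Multiset.mem_of_le h (Multiset.mem_cons_self _ _)
    obtain ⟨j, hj, hja⟩ := Multiset.mem_map.1 ha
    have hT := Multiset.cons_erase hj
    rw [← hT, Multiset.map_cons, hja, Multiset.cons_le_cons_iff] at h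
    obtain ⟨Q, h1, h2, h3⟩ := ih _ h
    refine ⟨(j, a) ::ₘ Q, by simp [h1], ?_, ?_⟩
    · intro q hq
      rcases Multiset.mem_cons.1 hq with rfl | hq
      · exact hja
      · exact h2 q hq
    · rw [Multiset.map_cons, ← hT]
      exact (Multiset.cons_le_cons_iff _).2 h3

theorem LMBM_le_cost {N₁ N₂ : ℕ} (X : Fin N₁ → EE d) (Y : Fin N₂ → EE d)
    (P : Multiset (EE d × EE d)) (h : Valid (msOf X) (msOf Y) P) : LMBM X Y ≤ cost P := by
  obtain ⟨Q, q1, q2, q3⟩ := lift_fst X Prod.fst P _ h.h1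
  have h2 : Q.map (fun q => q.2.2) ≤ (Finset.univ : Finset (Fin N₂)).val.map Y := by
    have := h.h2
    rw [← q1, Multiset.map_map] at this
    exact this
  obtain ⟨R, r1, r2, r3⟩ := lift_fst Y (fun q : Fin N₁ × (EE d × EE d) => q.2.2) Q _ h2
  have hc : R.card = min N₁ N₂ := by
    have := h.h3
    rw [msOf_card, msOf_card, ← q1, Multiset.card_map, ← r1, Multiset.card_map] at this
    exact this
  have n1 : (R.map (fun r => r.2.1)).Nodup := by
    have := nodup_le_univ _ q3
    rw [← r1, Multiset.map_map] at this
    exact this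
  have n2 : (R.map (fun r => r.1)).Nodup := nodup_le_univ _ r3
  have hP : P = R.map (fun r => r.2.2) := by
    rw [← q1, ← r1, Multiset.map_map]; rfl
  have hcost : cost P = (R.map (fun r => dist (X r.2.1) (Y r.1))).sum := by
    rw [cost, hP, Multiset.map_map]
    congr 1
    apply Multiset.map_congr rfl
    intro r hr
    have e1 : Y r.1 = r.2.2.2 := r2 r hr
    have e2 : X r.2.1 = r.2.2.1 := q2 r.2 (by rw [← r1]; exact Multiset.mem_map_of_mem _ hr)
    simp [e1, e2]
  have hR := msOf_toList R
  have hl : R.toList.length = min N₁ N₂ := by simp [hc]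
  have inj : ∀ {β : Type} (f : Fin N₂ × (Fin N₁ × (EE d × EE d)) → β), (R.map f).Nodup →
      Function.Injective (fun i : Fin (min N₁ N₂) => f (R.toList.get (Fin.cast hl.symm i))) := by
    intro β f hf
    rw [← hR, msOf_map, msOf, Multiset.nodup_map_iff_inj_on Finset.univ.nodup] at hf
    intro i j hij
    have := hf (Fin.cast hl.symm i) (by simp) (Fin.cast hl.symm j) (by simp) hij
    simpa [Fin.ext_iff] using this
  rw [LMBM_eq]
  refine (ciInf_le (Set.finite_range _).bddBelow
    (⟨_, inj (fun r => r.2.1) n1⟩, ⟨_, inj (fun r => r.1) n2⟩)).trans (le_of_eq ?_)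
  rw [hcost]
  conv_rhs => rw [← hR, msOf_map]
  change _ = ∑ i, _
  simp only [Function.Embedding.coeFn_mk]
  exact Fintype.sum_equiv (finCongr hl.symm) _ _ (fun i => rfl)

def Lm (S T : Multiset (EE d)) : ℝ := LMBM (fun i => S.toList.get i) (fun i => T.toList.get i)

theorem Lm_exists (S T : Multiset (EE d)) : ∃ P, Valid S T P ∧ cost P = Lm S T := by
  have := exists_valid (fun i => S.toList.get i) (fun i => T.toList.get i)
  rwa [msOf_toList, msOf_toList] at this

theorem Lm_le (S T : Multiset (EE d)) (P) (h : Valid S T P) : Lm S T ≤ cost P := by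
  apply LMBM_le_cost
  rwa [msOf_toList, msOf_toList]

theorem Lm_msOf {N₁ N₂ : ℕ} (X : Fin N₁ → EE d) (Y : Fin N₂ → EE d) :
    Lm (msOf X) (msOf Y) = LMBM X Y := by
  apply le_antisymm
  · obtain ⟨P, h, hP⟩ := exists_valid X Y
    rw [← hP]; exact Lm_le _ _ _ h
  · obtain ⟨P, h, hP⟩ := Lm_exists (msOf X) (msOf Y)
    rw [← hP]; exact LMBM_le_cost _ _ _ h

theorem Lm_nonneg (S T : Multiset (EE d)) : 0 ≤ Lm S T := LMBM_nonneg _ _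

theorem Lm_map_le (S T : Multiset (EE d)) (f : EE d → EE d) (c : ℝ)
    (hf : ∀ x y, dist (f x) (f y) = c * dist x y) :
    Lm (S.map f) (T.map f) ≤ c * Lm S T := by
  obtain ⟨P, h, hP⟩ := Lm_exists S T
  have hv : Valid (S.map f) (T.map f) (P.map (fun p => (f p.1, f p.2))) := by
    refine ⟨?_, ?_, ?_⟩
    · have := Multiset.map_le_map (f := f) h.h1
      simpa [Multiset.map_map, Function.comp_def] using this
    · have := Multiset.map_le_map (f := f) h.h2
      simpa [Multiset.map_map, Function.comp_def] using this
    · simp [h.h3]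
  refine (Lm_le _ _ _ hv).trans (le_of_eq ?_)
  rw [← hP, cost, cost, Multiset.map_map, ← Multiset.sum_map_mul_left]
  simp [hf]

theorem cost_le_card (P : Multiset (EE d × EE d)) (D : ℝ)
    (h : ∀ p ∈ P, dist p.1 p.2 ≤ D) : cost P ≤ D * P.card := by
  have := Multiset.sum_le_card_nsmul (P.map fun p => dist p.1 p.2) D (by
    intro x hx
    obtain ⟨p, hp, rfl⟩ := Multiset.mem_map.1 hx
    exact h p hp)
  simpa [cost, mul_comm] using this

theorem Lm_le_card (S T : Multiset (EE d)) (D : ℝ) (h : ∀ x ∈ S, ∀ y ∈ T, dist x y ≤ D) :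
    Lm S T ≤ D * (min S.card T.card : ℕ) := by
  obtain ⟨P, hv, hP⟩ := Lm_exists S T
  rw [← hP, ← hv.h3]
  apply cost_le_card
  intro p hp
  exact h _ (Multiset.mem_of_le hv.h1 (Multiset.mem_map_of_mem _ hp)) _
    (Multiset.mem_of_le hv.h2 (Multiset.mem_map_of_mem _ hp))

open Classical in
theorem Lm_split {ι : Type} [Fintype ι] (S T : Multiset (EE d)) (C : EE d → ι) (D : ℝ)
    (hD : 0 ≤ D)
    (h : ∀ x ∈ S, ∀ y ∈ T, dist x y ≤ D) :
    Lm S T ≤ ∑ i, (Lm (S.filter (fun x => C x = i)) (T.filter (fun x => C x = i)) +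
      D / 2 * |((S.filter (fun x => C x = i)).card : ℝ) - (T.filter (fun x => C x = i)).card|) := by
  have hsum : ∀ U : Multiset (EE d), ∑ i, U.filter (fun x => C x = i) = U := by
    intro U
    induction U using Multiset.induction_on with
    | empty => simp
    | cons a U ih =>
      conv_rhs => rw [← ih]
      have : ∀ i, (a ::ₘ U).filter (fun x => C x = i) =
          (if C a = i then {a} else 0) + U.filter (fun x => C x = i) := by
        intro i
        by_cases hi : C a = i
        · simp [hi]
        · simp [hi]
      simp only [this, Finset.sum_add_distrib]
      simp
  choose P hv hP using fun i => Lm_exists (S.filter (fun x => C x = i)) (T.filter (fun x => C x = i))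
  set Q := ∑ i, P i with hQ
  have hQ1 : Q.map Prod.fst ≤ S := by
    conv_rhs => rw [← hsum S]
    rw [hQ, ← Multiset.coe_mapAddMonoidHom, map_sum]
    exact Finset.sum_le_sum fun i _ => (hv i).h1
  have hQ2 : Q.map Prod.snd ≤ T := by
    conv_rhs => rw [← hsum T]
    rw [hQ, ← Multiset.coe_mapAddMonoidHom, map_sum]
    exact Finset.sum_le_sum fun i _ => (hv i).h2
  obtain ⟨R, hR, -⟩ := Lm_exists (S - Q.map Prod.fst) (T - Q.map Prod.snd)
  have hQS : Q.card ≤ S.card := by simpa using Multiset.card_le_card hQ1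
  have hQT : Q.card ≤ T.card := by simpa using Multiset.card_le_card hQ2
  have hRc : R.card + Q.card = min S.card T.card := by
    rw [hR.h3, Multiset.card_sub hQ1, Multiset.card_sub hQ2]
    simp only [Multiset.card_map]
    omega
  have hval : Valid S T (Q + R) := by
    refine ⟨?_, ?_, ?_⟩
    · rw [Multiset.map_add, add_comm]
      exact (add_le_add_left hR.h1 _).trans (tsub_add_cancel_of_le hQ1).le
    · rw [Multiset.map_add, add_comm]
      exact (add_le_add_left hR.h2 _).trans (tsub_add_cancel_of_le hQ2).le
    · rw [Multiset.card_add]; omega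
  have hcR : cost R ≤ D * R.card := by
    apply cost_le_card
    intro p hp
    exact h _ (Multiset.mem_of_le (hR.h1.trans (Multiset.sub_le_self _ _)) (Multiset.mem_map_of_mem _ hp)) _
      (Multiset.mem_of_le (hR.h2.trans (Multiset.sub_le_self _ _)) (Multiset.mem_map_of_mem _ hp))
  have hcQ : cost Q = ∑ i, cost (P i) := by
    unfold cost
    rw [hQ, ← Multiset.coe_mapAddMonoidHom, map_sum, ← Multiset.coe_sumAddMonoidHom, map_sum]
  have hcard : (R.card : ℝ) ≤ ∑ i, 1 / 2 * |((S.filter (fun x => C x = i)).card : ℝ) - (T.filter (fun x => C x = i)).card| := by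
    have e1 : (Q.card : ℝ) = ∑ i, (((S.filter (fun x => C x = i)).card : ℝ) / 2 + (T.filter (fun x => C x = i)).card / 2
      - 1 / 2 * |((S.filter (fun x => C x = i)).card : ℝ) - (T.filter (fun x => C x = i)).card|) := by
      rw [hQ, Multiset.card_sum, Nat.cast_sum]
      apply Finset.sum_congr rfl
      intro i _
      rw [(hv i).h3, Nat.cast_min]
      rcases le_total ((S.filter (fun x => C x = i)).card : ℝ) ((T.filter (fun x => C x = i)).card : ℝ) with h | h
      · rw [min_eq_left h, abs_of_nonpos (by linarith)]; ring
      · rw [min_eq_right h, abs_of_nonneg (by linarith)]; ring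
    have e2 : ∀ U : Multiset (EE d), (U.card : ℝ) = ∑ i, ((U.filter (fun x => C x = i)).card : ℝ) := by
      intro U
      conv_lhs => rw [← hsum U]
      rw [Multiset.card_sum, Nat.cast_sum]
    have e3 : (R.card : ℝ) + Q.card ≤ S.card / 2 + T.card / 2 := by
      have : ((R.card + Q.card : ℕ) : ℝ) = min (S.card : ℝ) T.card := by rw [hRc, Nat.cast_min]
      push_cast at this
      rw [this]
      have a1 := min_le_left (S.card : ℝ) T.card
      have a2 := min_le_right (S.card : ℝ) T.card
      linarith
    rw [e1, e2 S, e2 T, Finset.sum_sub_distrib, Finset.sum_add_distrib, ← Finset.sum_div, ← Finset.sum_div] at e3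
    linarith
  calc Lm S T ≤ cost (Q + R) := Lm_le _ _ _ hval
    _ = cost Q + cost R := by simp [cost]
    _ ≤ ∑ i, cost (P i) + D * ∑ i, 1 / 2 * |((S.filter (fun x => C x = i)).card : ℝ) - (T.filter (fun x => C x = i)).card| := by
      rw [hcQ]
      have := mul_le_mul_of_nonneg_left hcard hD
      linarith
    _ = _ := by
      rw [Finset.sum_add_distrib, Finset.mul_sum]
      simp only [hP]
      congr 1
      apply Finset.sum_congr rfl
      intro i _
      ring



open scoped ENNReal

def MM (g : Multiset (EE d) → ℝ≥0∞) : Prop := ∀ n, Measurable fun X : Fin n → EE d => g (msOf X)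

def MM2 (F : Multiset (EE d) → Multiset (EE d) → ℝ≥0∞) : Prop :=
  ∀ n m, Measurable fun p : (Fin n → EE d) × (Fin m → EE d) => F (msOf p.1) (msOf p.2)

def pw (l : ℝ) (n : ℕ) : ℝ≥0∞ := ENNReal.ofReal (Real.exp (-l) * l ^ n / n.factorial)

def Po (l : ℝ) (μ : Measure (EE d)) (g : Multiset (EE d) → ℝ≥0∞) : ℝ≥0∞ :=
  ∑' n, pw l n * ∫⁻ X, g (msOf X) ∂Measure.pi (fun _ : Fin n => μ)

theorem MM2.right {F : Multiset (EE d) → Multiset (EE d) → ℝ≥0∞} (h : MM2 F) (S) : MM (F S) := by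
  intro n
  have := (h S.toList.length n).comp (measurable_prodMk_left (x := fun i => S.toList.get i))
  have e : (fun X : Fin n → EE d => F S (msOf X)) =
    (fun X : Fin n → EE d => F (msOf (fun i => S.toList.get i)) (msOf X)) := by rw [msOf_toList]
  rw [e]
  exact this

theorem MM2.Po {F : Multiset (EE d) → Multiset (EE d) → ℝ≥0∞} (h : MM2 F) (l : ℝ)
    (μ : Measure (EE d)) [IsFiniteMeasure μ] : MM (fun S => Po l μ (F S)) := by
  intro n
  unfold _root_.Po
  refine Measurable.tsum fun m => Measurable.const_mul ?_ _
  exact (h n m).lintegral_prod_right'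

theorem msOf_mapφ_meas (n : ℕ) (f : EE d → EE d) (hf : Measurable f) :
    Measurable (fun X : Fin n → EE d => fun i => f (X i)) := by fun_prop

theorem MM.map {g : Multiset (EE d) → ℝ≥0∞} (h : MM g) (f : EE d → EE d) (hf : Measurable f) :
    MM (fun S => g (S.map f)) := by
  intro n
  simp only [msOf_map]
  exact (h n).comp (msOf_mapφ_meas n f hf)

theorem MM2.map_right {F : Multiset (EE d) → Multiset (EE d) → ℝ≥0∞} (h : MM2 F)
    (f : EE d → EE d) (hf : Measurable f) : MM2 (fun S T => F S (T.map f)) := by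
  intro n m
  simp only [msOf_map]
  exact (h n m).comp (measurable_fst.prodMk ((msOf_mapφ_meas m f hf).comp measurable_snd))

theorem MM2.map_left {F : Multiset (EE d) → Multiset (EE d) → ℝ≥0∞} (h : MM2 F)
    (f : EE d → EE d) (hf : Measurable f) : MM2 (fun S T => F (S.map f) T) := by
  intro n m
  simp only [msOf_map]
  exact (h n m).comp (((msOf_mapφ_meas n f hf).comp measurable_fst).prodMk measurable_snd)

theorem MM.cons {g : Multiset (EE d) → ℝ≥0∞} (h : MM g) (n : ℕ) :
    Measurable (fun p : EE d × (Fin n → EE d) => g (p.1 ::ₘ msOf p.2)) := by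
  simp only [← msOf_cons]
  refine (h (n+1)).comp ?_
  rw [measurable_pi_iff]
  intro i
  refine Fin.cases ?_ (fun j => ?_) i
  · simpa using measurable_fst
  · simp only [Fin.cons_succ]; fun_prop

open Classical in
theorem filter_msOf {n : ℕ} (C : Set (EE d)) (X : Fin n → EE d) (A : Finset (Fin n))
    (hA : ∀ j, X j ∈ C ↔ j ∈ A) :
    (msOf X).filter (· ∈ C) = msOf (fun i => X (A.orderEmbOfFin rfl i)) := by
  have h1 : msOf (fun i => A.orderEmbOfFin rfl i) = A.val := by
    have := congrArg Finset.val (Finset.map_orderEmbOfFin_univ A rfl)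
    exact this
  rw [← msOf_map (fun i => A.orderEmbOfFin rfl i) X, h1, msOf, Multiset.filter_map]
  congr 1
  have : A = Finset.univ.filter (fun j => X j ∈ C) := by ext j; simp [hA]
  rw [this]
  rfl

open Classical in
theorem MM2.filter {F : Multiset (EE d) → Multiset (EE d) → ℝ≥0∞} (h : MM2 F)
    (C : Set (EE d)) (hC : MeasurableSet C) :
    MM2 (fun S T => F (S.filter (· ∈ C)) (T.filter (· ∈ C))) := by
  intro n m s hs
  have : (fun p : (Fin n → EE d) × (Fin m → EE d) =>
      F ((msOf p.1).filter (· ∈ C)) ((msOf p.2).filter (· ∈ C))) ⁻¹' s =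
      ⋃ (A : Finset (Fin n)), ⋃ (B : Finset (Fin m)),
        (({p | ∀ j, p.1 j ∈ C ↔ j ∈ A} ∩ {p | ∀ j, p.2 j ∈ C ↔ j ∈ B}) ∩
        (fun p : (Fin n → EE d) × (Fin m → EE d) =>
          F (msOf (fun i => p.1 (A.orderEmbOfFin rfl i))) (msOf (fun i => p.2 (B.orderEmbOfFin rfl i)))) ⁻¹' s) := by
    ext p
    simp only [Set.mem_preimage, Set.mem_iUnion, Set.mem_inter_iff, Set.mem_ofPred_eq]
    constructor
    · intro hp
      refine ⟨Finset.univ.filter (fun j => p.1 j ∈ C), Finset.univ.filter (fun j => p.2 j ∈ C), ⟨by simp, by simp⟩, ?_⟩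
      rw [← filter_msOf C p.1 _ (by simp), ← filter_msOf C p.2 _ (by simp)]
      exact hp
    · rintro ⟨A, B, ⟨h1, h2⟩, h3⟩
      rw [filter_msOf C p.1 _ h1, filter_msOf C p.2 _ h2]
      exact h3
  rw [this]
  refine MeasurableSet.iUnion fun A => MeasurableSet.iUnion fun B =>
    MeasurableSet.inter (MeasurableSet.inter ?_ ?_) ?_
  · rw [Set.ofPred_forall]
    refine MeasurableSet.iInter fun j => ?_
    by_cases hj : j ∈ A
    · simp only [hj, iff_true]
      exact hC.preimage (by fun_prop : Measurable fun p : (Fin n → EE d) × (Fin m → EE d) => p.1 j)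
    · simp only [hj, iff_false]
      exact hC.compl.preimage (by fun_prop : Measurable fun p : (Fin n → EE d) × (Fin m → EE d) => p.1 j)
  · rw [Set.ofPred_forall]
    refine MeasurableSet.iInter fun j => ?_
    by_cases hj : j ∈ B
    · simp only [hj, iff_true]
      exact hC.preimage (by fun_prop : Measurable fun p : (Fin n → EE d) × (Fin m → EE d) => p.2 j)
    · simp only [hj, iff_false]
      exact hC.compl.preimage (by fun_prop : Measurable fun p : (Fin n → EE d) × (Fin m → EE d) => p.2 j)
  · suffices hh : Measurable (fun p : (Fin n → EE d) × (Fin m → EE d) =>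
        ((fun i => p.1 (A.orderEmbOfFin rfl i) : Fin A.card → EE d),
          (fun i => p.2 (B.orderEmbOfFin rfl i) : Fin B.card → EE d))) from
      ((h A.card B.card).comp hh) hs
    refine Measurable.prodMk ?_ ?_
    · rw [measurable_pi_iff]; intro i; fun_prop
    · rw [measurable_pi_iff]; intro i; fun_prop

theorem J_succ (μ : Measure (EE d)) [IsFiniteMeasure μ] (g : Multiset (EE d) → ℝ≥0∞) (n : ℕ)
    (hg : Measurable fun X : Fin (n+1) → EE d => g (msOf X)) :
    ∫⁻ X, g (msOf X) ∂Measure.pi (fun _ : Fin (n+1) => μ) =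
    ∫⁻ x, ∫⁻ v, g (x ::ₘ msOf v) ∂Measure.pi (fun _ : Fin n => μ) ∂μ := by
  have hm := (measurePreserving_piFinSuccAbove (fun _ : Fin (n+1) => μ) 0).symm
  rw [← hm.lintegral_comp hg]
  have e : ∀ p : EE d × (Fin n → EE d),
      msOf ((MeasurableEquiv.piFinSuccAbove (fun _ : Fin (n+1) => EE d) 0).symm p) = p.1 ::ₘ msOf p.2 := by
    intro p
    rw [← msOf_cons]
    simp only [MeasurableEquiv.piFinSuccAbove_symm_apply, Fin.insertNthEquiv]
    congr 1
    exact Fin.insertNth_zero' _ _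
  rw [lintegral_prod]
  · simp only [e]
  · exact (hg.comp (MeasurableEquiv.measurable _)).aemeasurable

open Classical in
theorem J_filter (μ : Measure (EE d)) [IsFiniteMeasure μ] (C : Set (EE d)) (hC : MeasurableSet C)
    (f : EE d → EE d) (hf : Measurable f) (p : ℝ≥0∞) (hp : μ.restrict C = p • μ.map f) (n : ℕ) :
    ∀ (g : Multiset (EE d) → ℝ≥0∞), MM g → MM (fun S => g (S.filter (· ∈ C))) →
    ∫⁻ X, g ((msOf X).filter (· ∈ C)) ∂Measure.pi (fun _ : Fin n => μ) =
    ∑ ij ∈ Finset.HasAntidiagonal.antidiagonal n, (n.choose ij.1 : ℝ≥0∞) *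
      (p ^ ij.1 * μ Cᶜ ^ ij.2 * ∫⁻ X, g ((msOf X).map f) ∂Measure.pi (fun _ : Fin ij.1 => μ)) := by
  induction n with
  | zero =>
    intro g hg _
    simp [msOf]
  | succ n ih =>
    intro g hg hgf
    have hgf' : ∀ x, MM (fun S => g (x ::ₘ S)) := fun x n => (hg.cons n).comp measurable_prodMk_left
    rw [J_succ μ (fun S => g (S.filter (· ∈ C))) n (hgf (n+1)), ← lintegral_add_compl _ hC]
    have h1 : ∫⁻ x in Cᶜ, ∫⁻ v, g ((x ::ₘ msOf v).filter (· ∈ C)) ∂Measure.pi (fun _ : Fin n => μ) ∂μ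
        = (∑ ij ∈ Finset.HasAntidiagonal.antidiagonal n, (n.choose ij.1 : ℝ≥0∞) *
      (p ^ ij.1 * μ Cᶜ ^ (ij.2) * ∫⁻ X, g ((msOf X).map f) ∂Measure.pi (fun _ : Fin ij.1 => μ))) * μ Cᶜ := by
      rw [← ih g hg hgf, ← setLIntegral_const]
      apply setLIntegral_congr_fun hC.compl
      intro x hx
      have hx' : x ∉ C := hx
      simp [hx']
    have h2 : ∫⁻ x in C, ∫⁻ v, g ((x ::ₘ msOf v).filter (· ∈ C)) ∂Measure.pi (fun _ : Fin n => μ) ∂μ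
        = ∑ ij ∈ Finset.HasAntidiagonal.antidiagonal n, (n.choose ij.2 : ℝ≥0∞) *
      (p ^ (ij.1 + 1) * μ Cᶜ ^ (ij.2) * ∫⁻ X, g ((msOf X).map f) ∂Measure.pi (fun _ : Fin (ij.1 + 1) => μ)) := by
      have hm : ∀ k : ℕ, Measurable (fun x => ∫⁻ v, g (x ::ₘ (msOf v).map f) ∂Measure.pi (fun _ : Fin k => μ)) := by
        intro k
        refine Measurable.lintegral_prod_right' (f := fun q : EE d × (Fin k → EE d) => g (q.1 ::ₘ (msOf q.2).map f)) ?_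
        simp only [msOf_map]
        exact (hg.cons k).comp (measurable_fst.prodMk ((msOf_mapφ_meas k f hf).comp measurable_snd))
      have hfilt : ∀ x ∈ C, MM (fun S => g (x ::ₘ S.filter (· ∈ C))) := by
        intro x hx k
        have h3 := (hgf.cons k).comp (measurable_prodMk_left (x := x))
        have e : (fun X : Fin k → EE d => g (x ::ₘ (msOf X).filter (· ∈ C))) =
           (fun X : Fin k → EE d => g ((x ::ₘ (msOf X)).filter (· ∈ C))) := by
          funext X; simp [hx]
        rw [e]
        exact h3
      calc _ = ∫⁻ x in C, ∑ ij ∈ Finset.HasAntidiagonal.antidiagonal n, (n.choose ij.1 : ℝ≥0∞) *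
            (p ^ ij.1 * μ Cᶜ ^ ij.2 * ∫⁻ v, g (x ::ₘ (msOf v).map f) ∂Measure.pi (fun _ : Fin ij.1 => μ)) ∂μ := by
            apply setLIntegral_congr_fun hC
            intro x hx
            have h3 := ih (fun S => g (x ::ₘ S)) (hgf' x) (hfilt x hx)
            simp only at h3 ⊢
            rw [← h3]
            simp [hx]
        _ = _ := by
            rw [hp, lintegral_smul_measure, lintegral_map (by fun_prop) hf,
              lintegral_finsetSum _ (by
                intro ij _
                exact ((((hm ij.1).comp hf)).const_mul _).const_mul _), Finset.smul_sum]
            apply Finset.sum_congr rfl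
            intro ij hij
            have hm' : Measurable (fun x => ∫⁻ v, g (f x ::ₘ (msOf v).map f) ∂Measure.pi (fun _ : Fin ij.1 => μ)) :=
              (hm ij.1).comp hf
            rw [lintegral_const_mul _ (hm'.const_mul _), lintegral_const_mul _ hm']
            rw [Nat.choose_symm_of_eq_add (Finset.HasAntidiagonal.mem_antidiagonal.1 hij).symm]
            rw [J_succ μ (fun S => g (S.map f)) ij.1 (hg.map f hf _)]
            simp only [Multiset.map_cons, smul_eq_mul]
            ring
    rw [h1, h2, Finset.sum_antidiagonal_choose_succ_mul (fun i j => p ^ i * μ Cᶜ ^ j * ∫⁻ X, g ((msOf X).map f) ∂Measure.pi (fun _ : Fin i => μ)) n,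
      add_comm, Finset.sum_mul]
    congr 1
    apply Finset.sum_congr rfl
    intro ij _
    ring

theorem pw_hasSum (l : ℝ) : HasSum (fun n : ℕ => Real.exp (-l) * l ^ n / n.factorial) 1 := by
  have := (NormedSpace.expSeries_div_hasSum_exp l).mul_left (Real.exp (-l))
  rw [← Real.exp_eq_exp_ℝ, ← Real.exp_add] at this
  simpa [mul_div_assoc] using this

theorem pw_tsum (l : ℝ) (hl : 0 ≤ l) : ∑' n, pw l n = 1 := by
  unfold pw
  rw [← ENNReal.ofReal_tsum_of_nonneg (fun n => by positivity) (pw_hasSum l).summable,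
    (pw_hasSum l).tsum_eq, ENNReal.ofReal_one]

open Classical in
theorem Po_filter (μ : Measure (EE d)) [IsProbabilityMeasure μ] (C : Set (EE d)) (hC : MeasurableSet C)
    (f : EE d → EE d) (hf : Measurable f) (p q : ℝ) (hp0 : 0 ≤ p) (hq0 : 0 ≤ q) (hpq : p + q = 1)
    (hp : μ.restrict C = ENNReal.ofReal p • μ.map f) (hq : μ Cᶜ = ENNReal.ofReal q)
    (g : Multiset (EE d) → ℝ≥0∞) (hg : MM g) (hg' : MM (fun S => g (S.filter (· ∈ C))))
    (l : ℝ) (hl : 0 ≤ l) :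
    Po l μ (fun S => g (S.filter (· ∈ C))) = Po (l * p) μ (fun S => g (S.map f)) := by
  unfold Po
  simp only [J_filter μ C hC f hf _ hp _ g hg hg', hq, Finset.mul_sum]
  set a : ℕ → ℝ≥0∞ := fun k => ∫⁻ X, g ((msOf X).map f) ∂Measure.pi (fun _ : Fin k => μ) with ha
  have key : ∀ n, ∀ ij ∈ Finset.HasAntidiagonal.antidiagonal n, pw l n * ((n.choose ij.1 : ℝ≥0∞) *
      (ENNReal.ofReal p ^ ij.1 * ENNReal.ofReal q ^ ij.2 * a ij.1)) =
      pw (l * p) ij.1 * a ij.1 * pw (l * q) ij.2 := by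
    rintro n ⟨i, j⟩ hij
    rw [Finset.HasAntidiagonal.mem_antidiagonal] at hij
    simp only at hij ⊢
    subst hij
    have : pw l (i + j) * (((i + j).choose i : ℝ≥0∞) * (ENNReal.ofReal p ^ i * ENNReal.ofReal q ^ j)) =
        pw (l * p) i * pw (l * q) j := by
      unfold pw
      rw [← ENNReal.ofReal_natCast, ← ENNReal.ofReal_pow hp0, ← ENNReal.ofReal_pow hq0,
        ← ENNReal.ofReal_mul (by positivity), ← ENNReal.ofReal_mul (by positivity),
        ← ENNReal.ofReal_mul (by positivity), ← ENNReal.ofReal_mul (by positivity)]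
      congr 1
      have e : Real.exp (-l) = Real.exp (-(l*p)) * Real.exp (-(l*q)) := by
        rw [← Real.exp_add]; congr 1; linear_combination l * hpq
      have h3 := Nat.choose_mul_factorial_mul_factorial (Nat.le_add_right i j)
      have h4 : (((i+j).choose i : ℝ)) * i.factorial * j.factorial = (i+j).factorial := by
        rw [Nat.add_sub_cancel_left] at h3
        exact_mod_cast h3
      have : ((i+j).factorial : ℝ) ≠ 0 := by positivity
      have : (i.factorial : ℝ) ≠ 0 := by positivity
      have : (j.factorial : ℝ) ≠ 0 := by positivity
      rw [e]
      field_simp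
      rw [← h4]
      ring
    calc _ = pw l (i + j) * (((i + j).choose i : ℝ≥0∞) * (ENNReal.ofReal p ^ i * ENNReal.ofReal q ^ j)) * a i := by ring
      _ = _ := by rw [this]; ring
  have h5 : ∀ n, ∑ ij ∈ Finset.HasAntidiagonal.antidiagonal n, pw l n * ((n.choose ij.1 : ℝ≥0∞) *
      (ENNReal.ofReal p ^ ij.1 * ENNReal.ofReal q ^ ij.2 * a ij.1)) =
      ∑' ij : Finset.HasAntidiagonal.antidiagonal n, pw (l * p) ij.1.1 * a ij.1.1 * pw (l * q) ij.1.2 := by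
    intro n
    rw [Finset.sum_congr rfl (key n), Finset.tsum_subtype (Finset.HasAntidiagonal.antidiagonal n)
      (fun ij => pw (l * p) ij.1 * a ij.1 * pw (l * q) ij.2)]
  refine (tsum_congr h5).trans ?_
  rw [← ENNReal.tsum_sigma (fun n (ij : Finset.HasAntidiagonal.antidiagonal n) => pw (l * p) ij.1.1 * a ij.1.1 * pw (l * q) ij.1.2)]
  rw [← Finset.HasAntidiagonal.sigmaAntidiagonalEquivProd.symm.tsum_eq]
  refine (ENNReal.tsum_prod (f := fun i j => pw (l * p) i * a i * pw (l * q) j)).trans ?_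
  refine tsum_congr fun i => ?_
  rw [ENNReal.tsum_mul_left, pw_tsum _ (by positivity), mul_one]


theorem pw_hasSum1 (l : ℝ) : HasSum (fun n : ℕ => Real.exp (-l) * l ^ n / n.factorial * n) l := by
  rw [← hasSum_nat_add_iff' 1]
  have := (pw_hasSum l).mul_left l
  simp only [Finset.range_one, Finset.sum_singleton, Nat.cast_zero, mul_zero, sub_zero]
  rw [mul_one] at this
  refine this.congr_fun fun n => ?_
  have : (n.factorial : ℝ) ≠ 0 := by positivity
  have : (n : ℝ) + 1 ≠ 0 := by positivity
  rw [Nat.factorial_succ]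
  push_cast
  field_simp
  ring

theorem pw_hasSum2 (l : ℝ) :
    HasSum (fun n : ℕ => Real.exp (-l) * l ^ n / n.factorial * (n : ℝ) ^ 2) (l ^ 2 + l) := by
  have h2 : HasSum (fun n : ℕ => Real.exp (-l) * l ^ n / n.factorial * ((n : ℝ) ^ 2 - n)) (l ^ 2) := by
    rw [← hasSum_nat_add_iff' 1]
    have := (pw_hasSum1 l).mul_left l
    simp only [Finset.range_one, Finset.sum_singleton, Nat.cast_zero]
    have e : l ^ 2 - Real.exp (-l) * l ^ 0 / (Nat.factorial 0 : ℝ) * (0 ^ 2 - 0) = l * l := by ring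
    rw [e]
    refine this.congr_fun fun n => ?_
    have : (n.factorial : ℝ) ≠ 0 := by positivity
    have : (n : ℝ) + 1 ≠ 0 := by positivity
    rw [Nat.factorial_succ]
    push_cast
    field_simp
    ring
  have := h2.add (pw_hasSum1 l)
  refine this.congr_fun fun n => ?_
  ring

theorem card_diff (l : ℝ) (hl : 0 < l) :
    ∑' n : ℕ, pw l n * ∑' m : ℕ, pw l m * ENNReal.ofReal |(n : ℝ) - m| ≤ ENNReal.ofReal (Real.sqrt (2 * l)) := by
  set t := Real.sqrt (2 * l) with ht
  have ht0 : 0 < t := Real.sqrt_pos.2 (by positivity)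
  have ht2 : t ^ 2 = 2 * l := Real.sq_sqrt (by positivity)
  have habs : ∀ x : ℝ, |x| ≤ x ^ 2 / (2 * t) + t / 2 := by
    intro x
    have : 0 ≤ (|x| - t) ^ 2 / (2 * t) := by positivity
    have e : (|x| - t) ^ 2 / (2 * t) = x ^ 2 / (2 * t) + t / 2 - |x| := by
      rw [← sq_abs x]; field_simp; ring
    linarith
  have h0 := pw_hasSum l
  have h1 := pw_hasSum1 l
  have h2 := pw_hasSum2 l
  have hin : ∀ n : ℕ, ∑' m : ℕ, pw l m * ENNReal.ofReal |(n : ℝ) - m| ≤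
      ENNReal.ofReal (((n : ℝ) ^ 2 - 2 * n * l + (l ^ 2 + l)) / (2 * t) + t / 2) := by
    intro n
    have hs : HasSum (fun m : ℕ => Real.exp (-l) * l ^ m / m.factorial * (((n : ℝ) - m) ^ 2 / (2 * t) + t / 2))
        (((n : ℝ) ^ 2 - 2 * n * l + (l ^ 2 + l)) / (2 * t) + t / 2) := by
      have := ((((h0.mul_left ((n : ℝ) ^ 2)).sub (h1.mul_left (2 * (n : ℝ)))).add h2).div_const (2 * t)).add
        (h0.mul_right (t / 2))
      rw [mul_one, one_mul] at this
      refine this.congr_fun fun m => ?_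
      ring
    rw [← hs.tsum_eq, ENNReal.ofReal_tsum_of_nonneg (fun m => by positivity) hs.summable]
    refine ENNReal.tsum_le_tsum fun m => ?_
    rw [pw, ← ENNReal.ofReal_mul (by positivity)]
    exact ENNReal.ofReal_le_ofReal (mul_le_mul_of_nonneg_left (habs _) (by positivity))
  have hs : HasSum (fun n : ℕ => Real.exp (-l) * l ^ n / n.factorial *
      (((n : ℝ) ^ 2 - 2 * n * l + (l ^ 2 + l)) / (2 * t) + t / 2)) t := by
    have := (((h2.sub (h1.mul_right (2 * l))).add (h0.mul_right (l ^ 2 + l))).div_const (2 * t)).add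
        (h0.mul_right (t / 2))
    have e : (l ^ 2 + l - l * (2 * l) + 1 * (l ^ 2 + l)) / (2 * t) + 1 * (t / 2) = t := by
      have : l = t ^ 2 / 2 := by linarith
      rw [this]
      field_simp
      ring
    rw [e] at this
    refine this.congr_fun fun m => ?_
    ring
  rw [← hs.tsum_eq, ENNReal.ofReal_tsum_of_nonneg (fun m => ?_) hs.summable]
  · refine ENNReal.tsum_le_tsum fun n => ?_
    rw [ENNReal.ofReal_mul (by positivity)]
    exact mul_le_mul_right (hin n) _
  · have : (m : ℝ) ^ 2 - 2 * m * l + (l ^ 2 + l) = (m - l) ^ 2 + l := by ring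
    rw [this]
    positivity

/-! cube -/

theorem unitCube_meas : MeasurableSet (unitCube d) := by
  unfold unitCube
  rw [Set.ofPred_forall]
  refine MeasurableSet.iInter fun i => ?_
  exact measurableSet_Icc.preimage (by fun_prop : Measurable fun x : EE d => x i)

theorem vol_cube : volume (unitCube d) = 1 := by
  have h := (PiLp.volume_preserving_ofLp (Fin d)).measure_preimage
    (s := Set.Icc (0 : Fin d → ℝ) 1) measurableSet_Icc.nullMeasurableSet
  rw [Real.volume_Icc_pi] at h
  have e : unitCube d = (WithLp.ofLp : EE d → (Fin d → ℝ)) ⁻¹' Set.Icc (0 : Fin d → ℝ) 1 := by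
    ext x
    simp [unitCube, Pi.le_def, forall_and]
  rw [e]
  exact h.trans (by simp)

instance unif_prob : IsProbabilityMeasure (unifCube d) :=
  ⟨by rw [unifCube, Measure.restrict_apply_univ, vol_cube]⟩

theorem vol_hyper (j : Fin d) (c : ℝ) : ∀ᵐ x : EE d, x j ≠ c := by
  have h := (PiLp.volume_preserving_ofLp (Fin d)).quasiMeasurePreserving.ae
    (p := fun y => y j ≠ c) (by
      have := Measure.pi_hyperplane (fun _ : Fin d => (volume : Measure ℝ)) j c
      rw [ae_iff]
      simp only [ne_eq, not_not]
      rw [volume_pi]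
      exact this)
  exact h

def cell (x : EE d) : Fin d → Bool := fun j => decide (1 / 2 ≤ x j)

def shiftV (b : Fin d → Bool) : EE d := WithLp.toLp 2 (fun j => if b j then (1 / 2 : ℝ) else 0)

def phi (b : Fin d → Bool) (x : EE d) : EE d := (1 / 2 : ℝ) • x + shiftV b

theorem phi_meas (b : Fin d → Bool) : Measurable (phi b) := by unfold phi; fun_prop

theorem phi_dist (b : Fin d → Bool) (x y : EE d) : dist (phi b x) (phi b y) = 1 / 2 * dist x y := by
  unfold phi
  rw [dist_add_right, dist_smul₀]
  norm_num

def cellS (b : Fin d → Bool) : Set (EE d) := {x | cell x = b}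

theorem cellS_meas (b : Fin d → Bool) : MeasurableSet (cellS b) := by
  have : cellS b = ⋂ j, {x : EE d | decide (1 / 2 ≤ x j) = b j} := by
    ext x; simp [cellS, cell, funext_iff]
  rw [this]
  refine MeasurableSet.iInter fun j => ?_
  have hm : MeasurableSet {x : EE d | 1 / 2 ≤ x j} :=
    measurableSet_le measurable_const (by fun_prop : Measurable fun x : EE d => x j)
  cases b j
  · convert hm.compl using 1
    ext x; simp
  · convert hm using 1
    ext x; simp

theorem cell_restrict (b : Fin d → Bool) :
    (unifCube d).restrict (cellS b) = ENNReal.ofReal ((1 / 2) ^ d) • (unifCube d).map (phi b) := by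
  ext s hs
  set D : Set (EE d) := {x | ∀ j, 2 * (x j - shiftV b j) ∈ Set.Icc (0 : ℝ) 1} with hD
  have hpre : phi b ⁻¹' (s ∩ D) = phi b ⁻¹' s ∩ unitCube d := by
    rw [Set.preimage_inter]
    congr 1
    ext x
    simp [hD, phi, unitCube]
  have hvol : volume (phi b ⁻¹' (s ∩ D)) = ENNReal.ofReal (2 ^ d) * volume (s ∩ D) := by
    have e : phi b ⁻¹' (s ∩ D) = (fun x : EE d => (1 / 2 : ℝ) • x) ⁻¹' ((fun x => x + shiftV b) ⁻¹' (s ∩ D)) := rfl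
    rw [e, Measure.addHaar_preimage_smul _ (by norm_num), measure_preimage_add_right]
    congr 2
    simp
  have hae : (s ∩ cellS b ∩ unitCube d : Set (EE d)) =ᵐ[volume] (s ∩ D : Set (EE d)) := by
    have : ∀ᵐ x : EE d, ∀ j, x j ≠ 1 / 2 := ae_all_iff.2 fun j => vol_hyper j _
    filter_upwards [this] with x hx
    apply propext
    change (x ∈ s ∩ cellS b ∩ unitCube d) ↔ (x ∈ s ∩ D)
    rw [Set.inter_assoc, Set.mem_inter_iff, Set.mem_inter_iff]
    refine and_congr_right fun _ => ?_
    simp only [cellS, cell, unitCube, hD, Set.mem_inter_iff, Set.mem_ofPred_eq, funext_iff, shiftV]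
    rw [← forall_and]
    refine forall_congr' fun j => ?_
    have hj := hx j
    cases b j
    · simp only [decide_eq_false_iff_not, Set.mem_Icc, not_le]
      constructor
      · rintro ⟨h1, h2, h3⟩
        norm_num
        constructor <;> linarith
      · norm_num
        intro h1 h2
        have := lt_of_le_of_ne (by linarith : x j ≤ 1 / 2) hj
        refine ⟨?_, ?_, ?_⟩ <;> linarith
    · simp only [decide_eq_true_iff, Set.mem_Icc]
      constructor
      · rintro ⟨h1, h2, h3⟩
        norm_num
        constructor <;> linarith
      · norm_num
        intro h1 h2
        refine ⟨?_, ?_, ?_⟩ <;> linarith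
  rw [Measure.restrict_apply hs, Measure.smul_apply, Measure.map_apply (phi_meas b) hs, unifCube,
    Measure.restrict_apply (hs.inter (cellS_meas b)), Measure.restrict_apply (phi_meas b hs), ← hpre, hvol,
    measure_congr hae, smul_eq_mul, ← mul_assoc, ← ENNReal.ofReal_mul (by positivity), ← mul_pow]
  norm_num

theorem cell_compl (b : Fin d → Bool) :
    (unifCube d) (cellS b)ᶜ = ENNReal.ofReal (1 - (1 / 2) ^ d) := by
  have h : unifCube d (cellS b) = ENNReal.ofReal ((1 / 2) ^ d) := by
    rw [← Measure.restrict_apply_univ, cell_restrict, Measure.smul_apply, Measure.map_apply (phi_meas b) MeasurableSet.univ]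
    simp
  rw [prob_compl_eq_one_sub (cellS_meas b), h, ENNReal.ofReal_sub _ (by positivity), ENNReal.ofReal_one]

theorem cube_dist (x y : EE d) (hx : x ∈ unitCube d) (hy : y ∈ unitCube d) : dist x y ≤ Real.sqrt d := by
  rw [EuclideanSpace.dist_eq]
  apply Real.sqrt_le_sqrt
  calc ∑ i, dist (x i) (y i) ^ 2 ≤ ∑ i : Fin d, (1 : ℝ) := by
        refine Finset.sum_le_sum fun i _ => ?_
        have h1 := hx i
        have h2 := hy i
        rw [Set.mem_Icc] at h1 h2
        rw [Real.dist_eq, sq_abs, sq_le_one_iff_abs_le_one, abs_le]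
        constructor <;> linarith
    _ = d := by simp

theorem Po_mono (l : ℝ) (g h : Multiset (EE d) → ℝ≥0∞)
    (hgh : ∀ S, (∀ x ∈ S, x ∈ unitCube d) → g S ≤ h S) : Po l (unifCube d) g ≤ Po l (unifCube d) h := by
  refine ENNReal.tsum_le_tsum fun n => ?_
  refine mul_le_mul_right ?_ _
  apply lintegral_mono_ae
  have : ∀ᵐ X ∂Measure.pi (fun _ : Fin n => unifCube d), ∀ j, X j ∈ unitCube d := by
    rw [ae_all_iff]
    intro j
    exact (Measure.quasiMeasurePreserving_eval (fun _ : Fin n => unifCube d) j).ae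
      (p := fun x => x ∈ unitCube d) (ae_restrict_mem unitCube_meas)
  filter_upwards [this] with X hX
  apply hgh
  intro x hx
  obtain ⟨j, -, rfl⟩ := Multiset.mem_map.1 hx
  exact hX j

theorem Po_sum {ι : Type} [Fintype ι] (l : ℝ) (μ : Measure (EE d)) (g : ι → Multiset (EE d) → ℝ≥0∞)
    (hg : ∀ i, MM (g i)) : Po l μ (fun S => ∑ i, g i S) = ∑ i, Po l μ (g i) := by
  unfold Po
  rw [← Summable.tsum_finsetSum (fun i _ => ENNReal.summable)]
  refine tsum_congr fun n => ?_
  rw [lintegral_finsetSum _ (fun i _ => hg i n), Finset.mul_sum]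

theorem Po_add (l : ℝ) (μ : Measure (EE d)) (g h : Multiset (EE d) → ℝ≥0∞)
    (hg : MM g) : Po l μ (fun S => g S + h S) = Po l μ g + Po l μ h := by
  unfold Po
  rw [← ENNReal.tsum_add]
  refine tsum_congr fun n => ?_
  rw [lintegral_add_left (hg n), mul_add]

theorem Po_mul (l : ℝ) (μ : Measure (EE d)) (c : ℝ≥0∞) (g : Multiset (EE d) → ℝ≥0∞)
    (hg : MM g) : Po l μ (fun S => c * g S) = c * Po l μ g := by
  unfold Po
  rw [← ENNReal.tsum_mul_left]
  refine tsum_congr fun n => ?_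
  rw [lintegral_const_mul _ (hg n)]
  ring

theorem Po_card (l : ℝ) (g : ℕ → ℝ≥0∞) : Po l (unifCube d) (fun S => g S.card) = ∑' n, pw l n * g n := by
  unfold Po
  simp [msOf_card]

def FL (S T : Multiset (EE d)) : ℝ≥0∞ := ENNReal.ofReal (Lm S T)

def FC (S T : Multiset (EE d)) : ℝ≥0∞ := ENNReal.ofReal |(S.card : ℝ) - T.card|

theorem FL_meas : MM2 (FL (d := d)) := by
  intro n m
  simp only [FL, Lm_msOf]
  exact (LMBM_measurable n m).ennreal_ofReal

theorem FC_meas : MM2 (FC (d := d)) := by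
  intro n m
  simp only [FC, msOf_card]
  exact measurable_const

def FT (S T : Multiset (EE d)) : ℝ≥0∞ := FL S T + ENNReal.ofReal (Real.sqrt d / 2) * FC S T

theorem FT_meas : MM2 (FT (d := d)) := fun n m =>
  (FL_meas n m).add ((FC_meas n m).const_mul _)

def QQ (d : ℕ) (l : ℝ) : ℝ≥0∞ := Po l (unifCube d) (fun S => Po l (unifCube d) (fun T => FL S T))

open Classical in
theorem FL_split (S T : Multiset (EE d)) (hS : ∀ x ∈ S, x ∈ unitCube d) (hT : ∀ x ∈ T, x ∈ unitCube d) :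
    FL S T ≤ ∑ b, FT (S.filter (· ∈ cellS b)) (T.filter (· ∈ cellS b)) := by
  have h := Lm_split S T cell (Real.sqrt d) (Real.sqrt_nonneg _)
    (fun x hx y hy => cube_dist x y (hS x hx) (hT y hy))
  refine (ENNReal.ofReal_le_ofReal h).trans (le_of_eq ?_)
  rw [ENNReal.ofReal_sum_of_nonneg (fun i _ => add_nonneg (Lm_nonneg _ _) (by positivity))]
  refine Finset.sum_congr rfl fun b _ => ?_
  rw [ENNReal.ofReal_add (Lm_nonneg _ _) (by positivity), ENNReal.ofReal_mul (by positivity)]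
  rfl

open Classical in
theorem Po2_filter (F : Multiset (EE d) → Multiset (EE d) → ℝ≥0∞) (hF : MM2 F) (b : Fin d → Bool)
    (l : ℝ) (hl : 0 ≤ l) :
    Po l (unifCube d) (fun S => Po l (unifCube d) (fun T => F (S.filter (· ∈ cellS b)) (T.filter (· ∈ cellS b)))) =
    Po (l * (1 / 2) ^ d) (unifCube d) (fun S => Po (l * (1 / 2) ^ d) (unifCube d)
      (fun T => F (S.map (phi b)) (T.map (phi b)))) := by
  have hp1 : ((1 : ℝ) / 2) ^ d ≤ 1 := pow_le_one₀ (by norm_num) (by norm_num)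
  have hfil := hF.filter _ (cellS_meas b)
  have e1 : (fun S : Multiset (EE d) => Po l (unifCube d) (fun T => F (S.filter (· ∈ cellS b)) (T.filter (· ∈ cellS b)))) =
      fun S => Po (l * (1 / 2) ^ d) (unifCube d) (fun T => F (S.filter (· ∈ cellS b)) (T.map (phi b))) := by
    funext S
    exact Po_filter (unifCube d) (cellS b) (cellS_meas b) (phi b) (phi_meas b) ((1 / 2) ^ d) (1 - (1 / 2) ^ d)
      (by positivity) (by linarith) (by ring) (cell_restrict b) (cell_compl b)
      (F (S.filter (· ∈ cellS b))) (hF.right _) (hfil.right S) l hl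
  have hm := hfil.Po l (unifCube d)
  rw [e1] at hm ⊢
  exact Po_filter (unifCube d) (cellS b) (cellS_meas b) (phi b) (phi_meas b) ((1 / 2) ^ d) (1 - (1 / 2) ^ d)
      (by positivity) (by linarith) (by ring) (cell_restrict b) (cell_compl b)
      (fun S => Po (l * (1 / 2) ^ d) (unifCube d) (fun T => F S (T.map (phi b))))
      ((hF.map_right _ (phi_meas b)).Po _ _) hm l hl

theorem QQ_step (l : ℝ) (hl : 0 < l) :
    QQ d l ≤ ENNReal.ofReal (2 ^ d) * (ENNReal.ofReal (1 / 2) * QQ d (l * (1 / 2) ^ d) +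
      ENNReal.ofReal (Real.sqrt d / 2) * ENNReal.ofReal (Real.sqrt (2 * (l * (1 / 2) ^ d)))) := by
  classical
  calc QQ d l ≤ Po l (unifCube d) (fun S => Po l (unifCube d) (fun T =>
        ∑ b, FT (S.filter (· ∈ cellS b)) (T.filter (· ∈ cellS b)))) :=
        Po_mono _ _ _ fun S hS => Po_mono _ _ _ fun T hT => FL_split S T hS hT
    _ = ∑ b, Po l (unifCube d) (fun S => Po l (unifCube d) (fun T =>
        FT (S.filter (· ∈ cellS b)) (T.filter (· ∈ cellS b)))) := by
        rw [← Po_sum _ _ _ (fun b => (FT_meas.filter _ (cellS_meas b)).Po _ _)]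
        congr 1
        funext S
        rw [Po_sum _ _ _ (fun b => (FT_meas.filter _ (cellS_meas b)).right S)]
    _ = ∑ b, Po (l * (1 / 2) ^ d) (unifCube d) (fun S => Po (l * (1 / 2) ^ d) (unifCube d)
      (fun T => FT (S.map (phi b)) (T.map (phi b)))) :=
        Finset.sum_congr rfl fun b _ => Po2_filter FT FT_meas b l hl.le
    _ ≤ ∑ b : Fin d → Bool, (ENNReal.ofReal (1 / 2) * QQ d (l * (1 / 2) ^ d) +
      ENNReal.ofReal (Real.sqrt d / 2) * ENNReal.ofReal (Real.sqrt (2 * (l * (1 / 2) ^ d)))) := by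
        refine Finset.sum_le_sum fun b _ => ?_
        set l' := l * (1 / 2) ^ d with hl'
        calc _ ≤ Po l' (unifCube d) (fun S => Po l' (unifCube d)
              (fun T => ENNReal.ofReal (1 / 2) * FL S T + ENNReal.ofReal (Real.sqrt d / 2) * FC S T)) := by
              refine Po_mono _ _ _ fun S _ => Po_mono _ _ _ fun T _ => ?_
              refine add_le_add ?_ (le_of_eq ?_)
              · rw [FL, FL, ← ENNReal.ofReal_mul (by norm_num)]
                exact ENNReal.ofReal_le_ofReal (Lm_map_le S T _ _ (phi_dist b))
              · simp [FC]
          _ = ENNReal.ofReal (1 / 2) * QQ d l' + ENNReal.ofReal (Real.sqrt d / 2) *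
              Po l' (unifCube d) (fun S => Po l' (unifCube d) (fun T => FC S T)) := by
              rw [QQ, ← Po_mul _ _ _ _ (FL_meas.Po _ _), ← Po_mul _ _ _ _ (FC_meas.Po _ _), ← Po_add]
              · congr 1
                funext S
                rw [← Po_mul _ _ _ _ (FL_meas.right S), ← Po_mul _ _ _ _ (FC_meas.right S), ← Po_add]
                exact fun n => (FL_meas.right S n).const_mul _
              · exact fun n => (FL_meas.Po _ _ n).const_mul _
          _ ≤ _ := by
              refine add_le_add le_rfl (mul_le_mul_right ?_ _)
              have e : (fun S : Multiset (EE d) => Po l' (unifCube d) (fun T => FC S T)) =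
                fun S => (fun n : ℕ => ∑' m : ℕ, pw l' m * ENNReal.ofReal |(n : ℝ) - m|) S.card := by
                funext S
                exact Po_card l' (fun m => ENNReal.ofReal |(S.card : ℝ) - m|)
              rw [e, Po_card l' (fun n : ℕ => ∑' m : ℕ, pw l' m * ENNReal.ofReal |(n : ℝ) - m|)]
              exact card_diff l' (by positivity)
    _ = _ := by
      rw [Finset.sum_const, nsmul_eq_mul]
      congr 1
      simp

theorem QQ_finite (l : ℝ) (hl : 0 ≤ l) : QQ d l ≠ ⊤ := by
  have h : QQ d l ≤ ∑' n : ℕ, pw l n * (∑' m : ℕ, pw l m * ENNReal.ofReal (Real.sqrt d * n)) := by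
    calc QQ d l ≤ Po l (unifCube d) (fun S => Po l (unifCube d) (fun T => ENNReal.ofReal (Real.sqrt d * S.card))) := by
          refine Po_mono _ _ _ fun S hS => Po_mono _ _ _ fun T hT => ?_
          refine ENNReal.ofReal_le_ofReal ?_
          refine (Lm_le_card S T (Real.sqrt d) (fun x hx y hy => cube_dist x y (hS x hx) (hT y hy))).trans ?_
          refine mul_le_mul_of_nonneg_left ?_ (Real.sqrt_nonneg _)
          exact_mod_cast min_le_left _ _
      _ = _ := by
        rw [← Po_card]
        congr 1
        funext S
        exact Po_card l (fun m => ENNReal.ofReal (Real.sqrt d * S.card))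
  refine ne_top_of_le_ne_top ?_ h
  simp only [ENNReal.tsum_mul_right, pw_tsum l hl, one_mul]
  have e : ∀ n : ℕ, pw l n * ENNReal.ofReal (Real.sqrt d * n) =
      ENNReal.ofReal (Real.sqrt d * (Real.exp (-l) * l ^ n / n.factorial * n)) := by
    intro n
    rw [pw, ← ENNReal.ofReal_mul (by positivity)]
    congr 1; ring
  simp only [e]
  rw [← ENNReal.ofReal_tsum_of_nonneg (fun n => by positivity) ((pw_hasSum1 l).mul_left _).summable]
  exact ENNReal.ofReal_ne_top

theorem MP_eq (l : ℝ) (hl : 0 ≤ l) : MP d l = (QQ d l).toReal := by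
  have e : QQ d l = ∑' n : ℕ, ∑' m : ℕ, pw l n * (pw l m *
      ∫⁻ p : (Fin n → EE d) × (Fin m → EE d), ENNReal.ofReal (LMBM p.1 p.2)
        ∂((Measure.pi fun _ => unifCube d).prod (Measure.pi fun _ => unifCube d))) := by
    unfold QQ Po
    refine tsum_congr fun n => ?_
    rw [ENNReal.tsum_mul_left]
    congr 1
    have hm : ∀ m : ℕ, Measurable (fun X : Fin n → EE d => ∫⁻ Y, FL (msOf X) (msOf Y) ∂Measure.pi (fun _ : Fin m => unifCube d)) :=
      fun m => (FL_meas n m).lintegral_prod_right'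
    rw [lintegral_tsum (fun m => ((hm m).const_mul _).aemeasurable)]
    refine tsum_congr fun m => ?_
    rw [lintegral_const_mul _ (hm m), lintegral_prod _ (LMBM_measurable n m).ennreal_ofReal.aemeasurable]
    simp only [FL, Lm_msOf]
  have hfin := QQ_finite (d := d) l hl
  rw [e] at hfin
  have h1 := ENNReal.ne_top_of_tsum_ne_top hfin
  have h2 := fun n => ENNReal.ne_top_of_tsum_ne_top (h1 n)
  rw [e, ENNReal.tsum_toReal_eq h1]
  unfold MP
  refine tsum_congr fun n => ?_
  rw [ENNReal.tsum_toReal_eq (h2 n)]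
  refine tsum_congr fun m => ?_
  rw [ENNReal.toReal_mul, ENNReal.toReal_mul, pw, pw, ENNReal.toReal_ofReal (by positivity),
    ENNReal.toReal_ofReal (by positivity),
    integral_eq_lintegral_of_nonneg_ae (Eventually.of_forall fun p => LMBM_nonneg _ _)
      (LMBM_measurable n m).aestronglyMeasurable]

theorem MP_step (hd : 1 ≤ d) (l : ℝ) (hl : 0 < l) :
    MP d l ≤ 2 ^ (d - 1) * MP d (l / 2 ^ d) + Real.sqrt (2 * d * l) * (2 : ℝ) ^ ((d : ℝ) / 2 - 1) := by
  have h := QQ_step (d := d) l hl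
  have hl' : 0 ≤ l * (1 / 2 : ℝ) ^ d := by positivity
  have hq := QQ_finite (d := d) _ hl'
  have h2 := ENNReal.toReal_mono (by finiteness) h
  rw [ENNReal.toReal_mul, ENNReal.toReal_add (by finiteness) (by finiteness), ENNReal.toReal_mul,
    ENNReal.toReal_mul, ENNReal.toReal_ofReal (by positivity), ENNReal.toReal_ofReal (by positivity),
    ENNReal.toReal_ofReal (by positivity), ENNReal.toReal_ofReal (by positivity), ← MP_eq l hl.le,
    ← MP_eq _ hl'] at h2
  have e1 : l * (1 / 2 : ℝ) ^ d = l / 2 ^ d := by rw [one_div, inv_pow]; rfl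
  rw [e1] at h2
  refine h2.trans (le_of_eq ?_)
  set r : ℝ := (2 : ℝ) ^ ((d : ℝ) / 2) with hr
  have hr0 : 0 < r := by positivity
  have hr2 : r ^ 2 = 2 ^ d := by
    rw [hr, ← Real.rpow_natCast, ← Real.rpow_mul (by norm_num), ← Real.rpow_natCast]
    congr 1
    push_cast
    ring
  have e2 : (2 : ℝ) ^ ((d : ℝ) / 2 - 1) = r / 2 := by
    rw [Real.rpow_sub (by norm_num), Real.rpow_one]
  have e3 : Real.sqrt (2 * (l / 2 ^ d)) = Real.sqrt (2 * l) / r := by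
    rw [← hr2, ← mul_div_assoc, Real.sqrt_div (by positivity), Real.sqrt_sq hr0.le]
  have e4 : Real.sqrt (2 * d * l) = Real.sqrt d * Real.sqrt (2 * l) := by
    rw [← Real.sqrt_mul (by positivity)]
    congr 1; ring
  have e5 : (2 : ℝ) ^ d = 2 ^ (d - 1) * 2 := by
    rw [← pow_succ, Nat.sub_add_cancel hd]
  rw [e2, e3, e4, mul_add]
  congr 1
  · rw [e5]; ring
  · rw [← hr2]; field_simp

end helpers

theorem MP_iter
    (d : ℕ) (hd : 1 ≤ d) (K : ℕ) : ∀ (N : ℝ) (_ : 0 < N),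
    MP d N ≤
      2 ^ (K * (d - 1)) * MP d (N / 2 ^ (K * d)) +
        Real.sqrt (2 * d * N) *
          ∑ k ∈ Finset.Icc 1 K, (2 : ℝ) ^ ((k : ℝ) * ((d : ℝ) / 2 - 1)) := by
  induction K with
  | zero => intro N hN; simp
  | succ K ih =>
    intro N hN
    have h1 := ih N hN
    have h2 := MP_step hd (N / 2 ^ (K * d)) (by positivity)
    have h3 := mul_le_mul_of_nonneg_left h2 (by positivity : (0 : ℝ) ≤ 2 ^ (K * (d - 1)))
    rw [Finset.sum_Icc_succ_top (by omega), mul_add]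
    have e1 : N / 2 ^ (K * d) / 2 ^ d = N / 2 ^ ((K + 1) * d) := by
      rw [div_div, ← pow_add]; congr 2; ring
    have e2 : (2 : ℝ) ^ ((K + 1) * (d - 1)) = 2 ^ (K * (d - 1)) * 2 ^ (d - 1) := by
      rw [← pow_add]; congr 1; ring
    have e3 : (2 : ℝ) ^ (K * (d - 1)) * (Real.sqrt (2 * d * (N / 2 ^ (K * d))) * (2 : ℝ) ^ ((d : ℝ) / 2 - 1)) =
        Real.sqrt (2 * d * N) * (2 : ℝ) ^ (((K + 1 : ℕ) : ℝ) * ((d : ℝ) / 2 - 1)) := by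
      have f1 : Real.sqrt (2 * d * (N / 2 ^ (K * d))) = Real.sqrt (2 * d * N) * (2 : ℝ) ^ (-((K : ℝ) * d / 2)) := by
        have : 2 * d * (N / 2 ^ (K * d)) = (2 * d * N) * ((2 : ℝ) ^ (-((K : ℝ) * d / 2))) ^ 2 := by
          have g : ((2:ℝ) ^ (-((K:ℝ)*d/2)))^2 = ((2:ℝ)^(K*d))⁻¹ := by
            rw [← Real.rpow_natCast ((2:ℝ) ^ (-((K:ℝ)*d/2))) 2, ← Real.rpow_mul (by norm_num),
              ← Real.rpow_natCast 2 (K*d), ← Real.rpow_neg (by norm_num)]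
            congr 1
            push_cast
            ring
          rw [g]
          ring
        rw [this, Real.sqrt_mul (by positivity), Real.sqrt_sq (by positivity)]
      rw [f1, ← Real.rpow_natCast 2 (K * (d - 1))]
      have f2 : ((K * (d - 1) : ℕ) : ℝ) = K * ((d : ℝ) - 1) := by
        rw [Nat.cast_mul, Nat.cast_sub hd, Nat.cast_one]
      rw [f2]
      have f3 : (2 : ℝ) ^ (((K + 1 : ℕ) : ℝ) * ((d : ℝ) / 2 - 1)) =
          2 ^ ((K : ℝ) * ((d : ℝ) - 1)) * 2 ^ (-((K : ℝ) * d / 2)) * 2 ^ ((d : ℝ) / 2 - 1) := by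
        rw [← Real.rpow_add (by norm_num), ← Real.rpow_add (by norm_num)]
        congr 1
        push_cast
        ring
      rw [f3]
      ring
    rw [mul_add, e1, ← mul_assoc, ← e2, e3] at h3
    linarith


/-- Subadditivity in the mean for the Poissonized minimum bipartite matching functional:
`M(N) ≤ 2^{K(d−1)} M(N/2^{Kd}) + √(2dN) ∑_{k=1}^{K} 2^{k(d/2−1)}`. -/
theorem MP_subadditive_dyadic
    (d : ℕ) (hd : 1 ≤ d) (N : ℝ) (hN : 0 < N) (K : ℕ) (hK : 1 ≤ K) :
    MP d N ≤
      2 ^ (K * (d - 1)) * MP d (N / 2 ^ (K * d)) +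
        Real.sqrt (2 * d * N) *
          ∑ k ∈ Finset.Icc 1 K, (2 : ℝ) ^ ((k : ℝ) * ((d : ℝ) / 2 - 1)) :=
  MP_iter d hd K N hN
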